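/- For every n ≥ 1, the fourth central moment of the Gepner statistic over all permutations of {1,…,n} equals n³(n−1)(n−2)(29n³ − 71n² − 26n − 16)/43200; that is, (1/n!) Σ_{π ∈ S_n} (gep(π) − n(n−1)(n−2)/12)⁴ = n³(n−1)(n−2)(29n³ − 71n² − 26n − 16)/43200 (as an identity in ℚ). -/

import Mathlib

/-- The Gepner statistic of a word `w = w 0 … w (m-1)` over a totally ordered
alphabet: the number of triples of positions `i < j < k` such that
`w_i w_j w_k` reduces to one of the odd permutations `132`, `213`, `321`. -/
def gep {m : ℕ} {α : Type*} [LinearOrder α] (w : Fin m → α) : ℕ :=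
  (Finset.univ.filter (fun t : Fin m × Fin m × Fin m =>
    t.1 < t.2.1 ∧ t.2.1 < t.2.2 ∧
      ((w t.1 < w t.2.2 ∧ w t.2.2 < w t.2.1) ∨
       (w t.2.1 < w t.1 ∧ w t.1 < w t.2.2) ∨
       (w t.2.2 < w t.2.1 ∧ w t.2.1 < w t.1)))).card

/-- real sign of `j - i` -/
noncomputable def gsg (i j : ℕ) : ℝ := if i < j then 1 else if j < i then -1 else 0

/-- circulant antisymmetric weights -/
noncomputable def gA (N i j : ℕ) : ℝ := N * gsg i j - 2 * ((j : ℝ) - i)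

lemma gsg_self (i : ℕ) : gsg i i = 0 := by simp [gsg]

lemma gsg_anti (i j : ℕ) : gsg i j = - gsg j i := by
  unfold gsg
  rcases lt_trichotomy i j with h | h | h
  · simp [h, h.not_gt]
  · simp [h]
  · simp [h, h.not_gt]

lemma gA_anti (N i j : ℕ) : gA N i j = - gA N j i := by
  unfold gA
  rw [gsg_anti i j]; ring

lemma gA_self (N i : ℕ) : gA N i i = 0 := by simp [gA, gsg_self]

lemma gsg_sum (g : ℕ → ℝ) (i N : ℕ) (h : i < N) :
    ∑ j ∈ Finset.range N, gsg i j * g j =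
      ∑ j ∈ Finset.range N, g j - ∑ j ∈ Finset.range i, g j - ∑ j ∈ Finset.range (i+1), g j := by
  obtain ⟨m, rfl⟩ := Nat.exists_eq_add_of_lt h
  clear h
  induction m with
  | zero =>
    have : ∑ j ∈ Finset.range i, gsg i j * g j = - ∑ j ∈ Finset.range i, g j := by
      rw [← Finset.sum_neg_distrib]
      refine Finset.sum_congr rfl fun j hj => ?_
      have := Finset.mem_range.1 hj
      simp [gsg, this, this.not_gt]
    simp only [add_zero]
    rw [Finset.sum_range_succ, this, gsg_self]; ring
  | succ m ih =>
    rw [show i + (m+1) + 1 = (i + m + 1) + 1 by ring, Finset.sum_range_succ, ih,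
      Finset.sum_range_succ g (i+m+1)]
    have : gsg i (i + m + 1) = 1 := by simp [gsg, show i < i + m + 1 by omega]
    rw [this]; ring

lemma gsum0 (M : ℕ) : ∑ j ∈ Finset.range M, (1:ℝ) = M := by simp
lemma gsum1 (M : ℕ) : ∑ j ∈ Finset.range M, (j:ℝ) = M * (M-1) / 2 := by
  induction M with
  | zero => simp
  | succ m ih => rw [Finset.sum_range_succ, ih]; push_cast; ring
lemma gsum2 (M : ℕ) : ∑ j ∈ Finset.range M, (j:ℝ)^2 = M * (M-1) * (2*M-1) / 6 := by
  induction M with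
  | zero => simp
  | succ m ih => rw [Finset.sum_range_succ, ih]; push_cast; ring
lemma gsum3 (M : ℕ) : ∑ j ∈ Finset.range M, (j:ℝ)^3 = (M * (M-1) / 2)^2 := by
  induction M with
  | zero => simp
  | succ m ih => rw [Finset.sum_range_succ, ih]; push_cast; ring
lemma gsum4 (M : ℕ) : ∑ j ∈ Finset.range M, (j:ℝ)^4 =
    (M:ℝ)^5/5 - (M:ℝ)^4/2 + (M:ℝ)^3/3 - M/30 := by
  induction M with
  | zero => simp
  | succ m ih => rw [Finset.sum_range_succ, ih]; push_cast; ring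
lemma gsum5 (M : ℕ) : ∑ j ∈ Finset.range M, (j:ℝ)^5 =
    (M:ℝ)^6/6 - (M:ℝ)^5/2 + 5*(M:ℝ)^4/12 - (M:ℝ)^2/12 := by
  induction M with
  | zero => simp
  | succ m ih => rw [Finset.sum_range_succ, ih]; push_cast; ring

lemma gsumlin (a b : ℝ) (M : ℕ) : ∑ j ∈ Finset.range M, (a + b * (j:ℝ)) =
    a * M + b * (M * (M-1) / 2) := by
  rw [Finset.sum_add_distrib, ← Finset.mul_sum, gsum1]; simp; ring

lemma gsumpoly (c0 c1 c2 c3 c4 c5 : ℝ) (M : ℕ) :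
    ∑ j ∈ Finset.range M, (c0 + c1 * (j:ℝ) + c2 * (j:ℝ)^2 + c3 * (j:ℝ)^3 + c4 * (j:ℝ)^4
      + c5 * (j:ℝ)^5) =
    c0 * M + c1 * (M * (M-1) / 2) + c2 * (M * (M-1) * (2*M-1) / 6) + c3 * (M * (M-1) / 2)^2
     + c4 * ((M:ℝ)^5/5 - (M:ℝ)^4/2 + (M:ℝ)^3/3 - M/30)
     + c5 * ((M:ℝ)^6/6 - (M:ℝ)^5/2 + 5*(M:ℝ)^4/12 - (M:ℝ)^2/12) := by
  simp only [Finset.sum_add_distrib, ← Finset.mul_sum, gsum1, gsum2, gsum3, gsum4, gsum5]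
  simp; ring

lemma gA_row (N i : ℕ) (h : i < N) : ∑ j ∈ Finset.range N, gA N i j = 0 := by
  have h1 := gsg_sum (fun _ => 1) i N h
  simp only [mul_one, gsum0] at h1
  have h2 := gsumlin (-(i:ℝ)) 1 N
  have : ∀ j : ℕ, gA N i j = N * gsg i j - 2 * (-(i:ℝ) + 1 * j) := fun j => by unfold gA; ring
  simp only [this]
  rw [Finset.sum_sub_distrib, ← Finset.mul_sum, ← Finset.mul_sum, h1, h2]
  push_cast; ring

/-- closed form of the square, as a function of the distance -/
noncomputable def gC (N d : ℕ) : ℝ :=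
  N * (-((N:ℝ)^2 + 2) / 3 + 2 * d * N - 2 * (d:ℝ)^2) + if d = 0 then (N:ℝ)^2 else 0

lemma gA_sq_le (N i k : ℕ) (hik : i ≤ k) (hk : k < N) :
    ∑ j ∈ Finset.range N, gA N i j * gA N j k = gC N (k - i) := by
  have hi : i < N := by omega
  have e1 : ∀ j : ℕ, gA N i j * gA N j k = (-(N:ℝ)^2) * (gsg i j * gsg k j)
      + (-2 * N) * (gsg i j * ((k:ℝ) + (-1) * j)) + (2 * N) * (gsg k j * (-(i:ℝ) + 1 * j))
      + ((-4 * i * k) + (4 * (i + k)) * (j:ℝ) + (-4) * (j:ℝ)^2 + 0 * (j:ℝ)^3 + 0 * (j:ℝ)^4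
      + 0 * (j:ℝ)^5) := fun j => by
    unfold gA; rw [gsg_anti j k]; ring
  simp only [e1]
  rw [Finset.sum_add_distrib, Finset.sum_add_distrib, Finset.sum_add_distrib,
    ← Finset.mul_sum, ← Finset.mul_sum, ← Finset.mul_sum, gsumpoly, gsg_sum _ i N hi,
    gsg_sum _ i N hi, gsg_sum _ k N hk]
  simp only [gsumlin]
  have h1 := gsg_sum (fun _ => 1) k N hk
  simp only [mul_one, gsum0] at h1
  have h2 : ∑ j ∈ Finset.range i, gsg k j = -i := by
    rw [show (-(i:ℝ)) = ∑ j ∈ Finset.range i, (-1:ℝ) by simp]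
    refine Finset.sum_congr rfl fun j hj => ?_
    have := Finset.mem_range.1 hj
    simp [gsg, show j < k by omega, show ¬ k < j by omega]
  rw [Finset.sum_range_succ (gsg k) i, h1, h2]
  unfold gC
  obtain ⟨d, rfl⟩ := Nat.exists_eq_add_of_le hik
  rcases Nat.eq_zero_or_pos d with h0 | h0
  · subst h0
    simp only [add_zero, gsg_self]
    simp; ring
  · have : gsg (i+d) i = -1 := by simp [gsg, h0, show ¬ (i + d < i) by omega]
    rw [this]
    simp [h0.ne']
    ring

/-- natural distance -/
def gd (i j : ℕ) : ℕ := (i - j) + (j - i)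

lemma gA_sq (N i k : ℕ) (hi : i < N) (hk : k < N) :
    ∑ j ∈ Finset.range N, gA N i j * gA N j k = gC N (gd i k) := by
  rcases le_total i k with h | h
  · rw [gA_sq_le N i k h hk, gd, Nat.sub_eq_zero_of_le h, zero_add]
  · have := gA_sq_le N k i h hi
    rw [gd, Nat.sub_eq_zero_of_le h, add_zero, ← this]
    refine Finset.sum_congr rfl fun j _ => ?_
    rw [gA_anti N i j, gA_anti N j k]; ring

lemma gdist_sum (g : ℕ → ℝ) (M : ℕ) :
    ∑ i ∈ Finset.range M, ∑ k ∈ Finset.range M, g (gd i k) =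
      2 * ∑ d ∈ Finset.range M, ((M:ℝ) - d) * g d - M * g 0 := by
  induction M with
  | zero => simp
  | succ m ih =>
    have hr : ∑ k ∈ Finset.range m, g (gd m k) = ∑ d ∈ Finset.range (m+1), g d - g 0 := by
      rw [Finset.sum_range_succ', ← Finset.sum_range_reflect]
      simp only [add_sub_cancel_right]
      refine Finset.sum_congr rfl fun j hj => ?_
      have := Finset.mem_range.1 hj
      congr 1; unfold gd; omega
    have hs : ∀ i k, gd i k = gd k i := fun i k => by unfold gd; omega
    have e : ∀ i ∈ Finset.range m, ∑ k ∈ Finset.range (m+1), g (gd i k) =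
        ∑ k ∈ Finset.range m, g (gd i k) + g (gd m i) := fun i _ => by
      rw [Finset.sum_range_succ, hs i m]
    rw [Finset.sum_range_succ, Finset.sum_congr rfl e, Finset.sum_add_distrib, ih,
      Finset.sum_range_succ (fun k => g (gd m k)), hr]
    have e2 : ∑ d ∈ Finset.range (m+1), (((m+1:ℕ):ℝ) - d) * g d =
        ∑ d ∈ Finset.range m, ((m:ℝ) - d) * g d + ∑ d ∈ Finset.range (m+1), g d := by
      rw [Finset.sum_range_succ, Finset.sum_range_succ g, ← add_assoc, ← Finset.sum_add_distrib]
      congr 1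
      · refine Finset.sum_congr rfl fun j hj => ?_
        push_cast; ring
      · push_cast; ring
    rw [e2]
    simp only [gd, Nat.sub_self, add_zero]
    push_cast; ring

lemma gA_sq_dist (N i k : ℕ) : gA N i k ^ 2 =
    ((N:ℝ) - 2 * gd i k) ^ 2 - if gd i k = 0 then (N:ℝ)^2 else 0 := by
  unfold gA gsg gd
  rcases lt_trichotomy i k with h | h | h
  · obtain ⟨d, rfl⟩ := Nat.exists_eq_add_of_lt h
    simp [show i - (i + d + 1) = 0 by omega, show i + d + 1 - i = d + 1 by omega,
      show i < i + d + 1 by omega]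
    ring
  · subst h; simp
  · obtain ⟨d, rfl⟩ := Nat.exists_eq_add_of_lt h
    simp [show k - (k + d + 1) = 0 by omega, show k + d + 1 - k = d + 1 by omega,
      show k < k + d + 1 by omega, show ¬ k + d + 1 < k by omega]
    ring

lemma gdist_poly (g : ℕ → ℝ) (c0 c1 c2 c3 c4 e : ℝ) (M : ℕ)
    (h : ∀ d, g d = c0 + c1 * (d:ℝ) + c2 * (d:ℝ)^2 + c3 * (d:ℝ)^3 + c4 * (d:ℝ)^4
      + if d = 0 then e else 0) :
    ∑ i ∈ Finset.range M, ∑ k ∈ Finset.range M, g (gd i k) =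
      2 * ((M * c0) * M + (M * c1 - c0) * (M * (M-1) / 2) +
        (M * c2 - c1) * (M * (M-1) * (2*M-1) / 6) + (M * c3 - c2) * (M * (M-1) / 2)^2
     + (M * c4 - c3) * ((M:ℝ)^5/5 - (M:ℝ)^4/2 + (M:ℝ)^3/3 - M/30)
     + (-c4) * ((M:ℝ)^6/6 - (M:ℝ)^5/2 + 5*(M:ℝ)^4/12 - (M:ℝ)^2/12)) - M * c0 + M * e := by
  rw [gdist_sum, ← gsumpoly]
  have : ∀ d : ℕ, ((M:ℝ) - d) * g d = (M * c0 + (M * c1 - c0) * (d:ℝ) + (M * c2 - c1) * (d:ℝ)^2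
      + (M * c3 - c2) * (d:ℝ)^3 + (M * c4 - c3) * (d:ℝ)^4 + (-c4) * (d:ℝ)^5)
      + if d = 0 then M * e else 0 := fun d => by
    rw [h]
    split_ifs with h0
    · subst h0; simp; ring
    · ring
  simp only [this]
  rw [Finset.sum_add_distrib, h 0]
  rcases Nat.eq_zero_or_pos M with h0 | h0
  · subst h0; simp
  · simp [h0, Finset.sum_ite_eq']
    ring

lemma g_a2 (N : ℕ) : ∑ i ∈ Finset.range N, ∑ k ∈ Finset.range N, gA N i k ^ 2 =
    (N:ℝ)^4/3 - N^3 + 2/3 * (N:ℝ)^2 := by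
  simp only [gA_sq_dist]
  rw [gdist_poly (fun d => ((N:ℝ) - 2 * d) ^ 2 - if d = 0 then (N:ℝ)^2 else 0)
    (N^2) (-4*N) 4 0 0 (-N^2)]
  · ring
  · intro d; split_ifs <;> ring

lemma g_a4 (N : ℕ) : ∑ i ∈ Finset.range N, ∑ k ∈ Finset.range N, gA N i k ^ 4 =
    (N:ℝ)^6/5 - N^5 + 4/3 * (N:ℝ)^4 - 8/15 * (N:ℝ)^2 := by
  have : ∀ i k, gA N i k ^ 4 = (gA N i k ^ 2)^2 := fun i k => by ring
  simp only [this, gA_sq_dist]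
  rw [gdist_poly (fun d => (((N:ℝ) - 2 * d) ^ 2 - if d = 0 then (N:ℝ)^2 else 0)^2)
    (N^4) (-8*N^3) (24*N^2) (-32*N) 16 (-N^4)]
  · ring
  · intro d; split_ifs with h
    · subst h; simp
    · ring

lemma g_t (N : ℕ) : ∑ i ∈ Finset.range N, ∑ k ∈ Finset.range N, gA N i k ^ 2 * gC N (gd i k) =
    -(2/45 * (N:ℝ)^7 - 1/3 * (N:ℝ)^6 + 7/9 * (N:ℝ)^5 - 2/3 * (N:ℝ)^4 + 8/45 * (N:ℝ)^3) := by
  simp only [gA_sq_dist, gC]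
  rw [gdist_poly (fun d => (((N:ℝ) - 2 * d) ^ 2 - if d = 0 then (N:ℝ)^2 else 0) *
     (N * (-((N:ℝ)^2 + 2) / 3 + 2 * d * N - 2 * (d:ℝ)^2) + if d = 0 then (N:ℝ)^2 else 0))
    (N^3 * (-((N:ℝ)^2 + 2) / 3)) (N*(2*N^3 + 4*N*((N:ℝ)^2 + 2) / 3))
    (N*(-2*N^2-8*N^2 - 4*((N:ℝ)^2 + 2) / 3)) (N*(8*N+8*N)) (-8*N) (N^3 * (((N:ℝ)^2 + 2) / 3))]
  · ring
  · intro d; split_ifs with h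
    · subst h; simp; ring
    · ring

lemma g_c4 (N : ℕ) : ∑ i ∈ Finset.range N, ∑ k ∈ Finset.range N, gC N (gd i k) ^ 2 =
    1/45 * (N:ℝ)^8 - 4/9 * (N:ℝ)^6 + (N:ℝ)^5 - 26/45 * (N:ℝ)^4 := by
  rw [gdist_poly (fun d => gC N d ^ 2)
    (N^2 * (((N:ℝ)^2 + 2) / 3)^2) (-4*N^3*(((N:ℝ)^2 + 2) / 3))
    (N^2*(4*N^2 + 4*((N:ℝ)^2 + 2) / 3)) (-8*N^3) (4*N^2)
    (N^4 - 2 * N^3 * (((N:ℝ)^2 + 2) / 3))]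
  · ring
  · intro d; unfold gC; split_ifs with h
    · subst h; simp; ring
    · ring

section moment

set_option linter.unusedSectionVars false

variable {ι G : Type} [Fintype ι] [DecidableEq ι] [Fintype G] [Nonempty G]

/-- expectation over uniformly random words -/
noncomputable def gE : ((ι → G) → ℝ) →ₗ[ℝ] ℝ where
  toFun f := (∑ w, f w) / (Fintype.card (ι → G) : ℝ)
  map_add' f g := by simp [Finset.sum_add_distrib, add_div]
  map_smul' c f := by simp [← Finset.mul_sum, mul_div_assoc]

lemma gE_const (c : ℝ) : gE (fun _ : ι → G => c) = c := by
  have : (Fintype.card (ι → G) : ℝ) ≠ 0 := by exact_mod_cast Fintype.card_ne_zero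
  change (∑ w : ι → G, c) / _ = c
  simp only [Finset.sum_const, Finset.card_univ, nsmul_eq_mul]
  field_simp

lemma gE_upd (k : ι) (f : (ι → G) → ℝ) :
    gE f = gE (fun w => (∑ a, f (Function.update w k a)) / (Fintype.card G : ℝ)) := by
  have hc : (Fintype.card G : ℝ) ≠ 0 := by exact_mod_cast Fintype.card_ne_zero
  change (∑ w, f w) / _ = (∑ w, (∑ a, f (Function.update w k a)) / (Fintype.card G : ℝ)) / _
  congr 1
  rw [← Finset.sum_div, eq_div_iff hc]
  have hinv : Function.Involutive
      (fun p : (ι → G) × G => (Function.update p.1 k p.2, p.1 k)) := by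
    rintro ⟨w, a⟩
    simp
  have := Equiv.sum_comp (hinv.toPerm) (fun p : (ι → G) × G => f p.1)
  rw [Fintype.sum_prod_type, Fintype.sum_prod_type] at this
  simp only [Function.Involutive.coe_toPerm] at this
  rw [this]
  rw [Finset.sum_mul]
  refine Finset.sum_congr rfl fun w _ => ?_
  simp [mul_comm]

/-- `u` does not depend on coordinate `k` -/
def gInd (k : ι) (u : (ι → G) → ℝ) : Prop := ∀ w a, u (Function.update w k a) = u w

lemma gInd.mul {k : ι} {u v : (ι → G) → ℝ} (hu : gInd k u) (hv : gInd k v) : gInd k (u * v) :=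
  fun w a => by simp [hu w a, hv w a]
lemma gInd.add {k : ι} {u v : (ι → G) → ℝ} (hu : gInd k u) (hv : gInd k v) : gInd k (u + v) :=
  fun w a => by simp [hu w a, hv w a]
lemma gInd.pow {k : ι} {u : (ι → G) → ℝ} (hu : gInd k u) (n : ℕ) : gInd k (u ^ n) :=
  fun w a => by simp [hu w a]
lemma gInd.smul {k : ι} {u : (ι → G) → ℝ} (c : ℝ) (hu : gInd k u) : gInd k (c • u) :=
  fun w a => by simp [hu w a]
lemma gInd.sum {k : ι} {κ : Type} (s : Finset κ) (u : κ → (ι → G) → ℝ)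
    (h : ∀ x ∈ s, gInd k (u x)) : gInd k (∑ x ∈ s, u x) :=
  fun w a => by
    simp only [Finset.sum_apply]
    exact Finset.sum_congr rfl fun x hx => h x hx w a

/-- the basic edge variables -/
def gh (A : ι → ι → ℝ) (b : G → G → ℝ) (i j : ι) : (ι → G) → ℝ :=
  fun w => A i j * b (w i) (w j)

variable {A : ι → ι → ℝ} {b : G → G → ℝ}

lemma gh_symm (hA : ∀ i j, A i j = - A j i) (hb : ∀ x y, b x y = - b y x) (i j : ι) :
    gh A b i j = gh A b j i := by
  funext w; unfold gh; rw [hA i j, hb]; ring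

lemma gh_self (hA : ∀ i j, A i j = - A j i) (i : ι) : gh A b i i = 0 := by
  funext w
  have : A i i = 0 := by linarith [hA i i]
  simp [gh, this]

lemma gh_ind {k p q : ι} (h1 : k ≠ p) (h2 : k ≠ q) : gInd k (gh A b p q) := by
  intro w a
  simp [gh, Function.update_of_ne h1.symm, Function.update_of_ne h2.symm]

lemma gE_zero (hA : ∀ i j, A i j = - A j i) (hb0 : ∀ y, ∑ x, b x y = 0) {k l : ι}
    {u : (ι → G) → ℝ} (hu : gInd k u) : gE (gh A b k l * u) = 0 := by
  by_cases hkl : k = l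
  · subst hkl; rw [gh_self hA]; simp
  rw [gE_upd k]
  have : ∀ w : ι → G, ∑ a, (gh A b k l * u) (Function.update w k a) = 0 := by
    intro w
    simp only [Pi.mul_apply, hu w, gh, Function.update_self,
      Function.update_of_ne (Ne.symm hkl)]
    rw [← Finset.sum_mul, ← Finset.mul_sum, hb0]; simp
  simp only [this, zero_div]
  exact gE_const 0

lemma gE_two {i j : ι} (hij : i ≠ j) (f : G → G → ℝ) :
    gE (fun w : ι → G => f (w i) (w j)) = (∑ x, ∑ y, f x y) / (Fintype.card G : ℝ)^2 := by
  rw [gE_upd i, gE_upd j]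
  simp only [Function.update_self, Function.update_of_ne hij.symm]
  rw [gE_const, Finset.sum_comm, ← Finset.sum_div]
  rw [div_div, sq]

lemma gE_three {i j k : ι} (hij : i ≠ j) (hik : i ≠ k) (hjk : j ≠ k) (f : G → G → G → ℝ) :
    gE (fun w : ι → G => f (w i) (w j) (w k)) =
      (∑ x, ∑ y, ∑ z, f x y z) / (Fintype.card G : ℝ)^3 := by
  rw [gE_upd k]
  simp only [Function.update_self, Function.update_of_ne hik, Function.update_of_ne hjk]
  rw [gE_two hij (fun x y => (∑ z, f x y z) / (Fintype.card G : ℝ))]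
  simp only [← Finset.sum_div]
  rw [div_div]; ring_nf

lemma gE_four {i j k l : ι} (hij : i ≠ j) (hik : i ≠ k) (hjk : j ≠ k) (hil : i ≠ l)
    (hjl : j ≠ l) (hkl : k ≠ l) (f : G → G → G → G → ℝ) :
    gE (fun w : ι → G => f (w i) (w j) (w k) (w l)) =
      (∑ x, ∑ y, ∑ z, ∑ t, f x y z t) / (Fintype.card G : ℝ)^4 := by
  rw [gE_upd l]
  simp only [Function.update_self, Function.update_of_ne hil, Function.update_of_ne hjl,
    Function.update_of_ne hkl]
  rw [gE_three hij hik hjk (fun x y z => (∑ t, f x y z t) / (Fintype.card G : ℝ))]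
  simp only [← Finset.sum_div]
  rw [div_div]; ring_nf

lemma gval4 {i j : ι} (hij : i ≠ j) : gE (gh A b i j ^ 4) =
    A i j ^ 4 * ((∑ x, ∑ y, b x y ^ 4) / (Fintype.card G : ℝ)^2) := by
  have := gE_two (G := G) hij (fun x y => (A i j * b x y)^4)
  simp only [mul_pow, ← Finset.mul_sum] at this
  rw [mul_div_assoc] at this
  rw [← this]
  congr 1; funext w; simp [gh, mul_pow]

lemma gval22_disj {i j k l : ι} (hij : i ≠ j) (hik : i ≠ k) (hjk : j ≠ k) (hil : i ≠ l)
    (hjl : j ≠ l) (hkl : k ≠ l) : gE (gh A b i j ^ 2 * gh A b k l ^ 2) =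
    A i j ^ 2 * A k l ^ 2 * ((∑ x, ∑ y, b x y ^ 2) / (Fintype.card G : ℝ)^2)^2 := by
  have := gE_four (G := G) hij hik hjk hil hjl hkl
    (fun x y z t => (A i j * b x y)^2 * (A k l * b z t)^2)
  simp only [mul_pow, ← Finset.mul_sum, ← Finset.sum_mul] at this
  rw [show gh A b i j ^ 2 * gh A b k l ^ 2 = fun w : ι → G => A i j ^ 2 * b (w i) (w j) ^ 2 *
    (A k l ^ 2 * b (w k) (w l) ^ 2) by funext w; simp [gh, mul_pow], this]
  ring

/-- constant row norm -/
lemma gval22_adj {i j k : ι} (hij : i ≠ j) (hik : i ≠ k) (hjk : j ≠ k)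
    (hr : ∀ x, ∑ y, b x y ^ 2 = (∑ x, ∑ y, b x y ^ 2) / (Fintype.card G : ℝ)) :
    gE (gh A b i j ^ 2 * gh A b i k ^ 2) =
    A i j ^ 2 * A i k ^ 2 * ((∑ x, ∑ y, b x y ^ 2) / (Fintype.card G : ℝ)^2)^2 := by
  have hc : (Fintype.card G : ℝ) ≠ 0 := by exact_mod_cast Fintype.card_ne_zero
  have := gE_three (G := G) hij hik hjk
    (fun x y z => (A i j * b x y)^2 * (A i k * b x z)^2)
  simp only [mul_pow, ← Finset.mul_sum, ← Finset.sum_mul] at this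
  rw [show gh A b i j ^ 2 * gh A b i k ^ 2 = fun w : ι → G => A i j ^ 2 * b (w i) (w j) ^ 2 *
    (A i k ^ 2 * b (w i) (w k) ^ 2) by funext w; simp [gh, mul_pow], this]
  generalize (∑ x, ∑ y, b x y ^ 2) = p at hr ⊢
  simp only [hr]
  simp only [Finset.sum_const, Finset.card_univ, nsmul_eq_mul]
  field_simp

lemma gval_tri {i j k : ι} (hij : i ≠ j) (hik : i ≠ k) (hjk : j ≠ k) :
    gE (gh A b i j ^ 2 * (gh A b i k * gh A b j k)) =
    A i j ^ 2 * (A i k * A j k) *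
      ((∑ x, ∑ y, ∑ z, b x y ^ 2 * (b x z * b y z)) / (Fintype.card G : ℝ)^3) := by
  rw [← mul_div_assoc, Finset.mul_sum]
  simp only [Finset.mul_sum]
  rw [← gE_three hij hik hjk
    (fun x y z => A i j ^ 2 * (A i k * A j k) * (b x y ^ 2 * (b x z * b y z)))]
  congr 1; funext w; simp [gh]; ring

lemma gval_cyc {i j k l : ι} (hij : i ≠ j) (hik : i ≠ k) (hjk : j ≠ k) (hil : i ≠ l)
    (hjl : j ≠ l) (hkl : k ≠ l) :
    gE (gh A b i j * gh A b i k * gh A b j l * gh A b k l) =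
    A i j * A i k * A j l * A k l *
      ((∑ x, ∑ y, ∑ z, ∑ t, b x y * b x z * b y t * b z t) / (Fintype.card G : ℝ)^4) := by
  rw [← mul_div_assoc, Finset.mul_sum]
  simp only [Finset.mul_sum]
  rw [← gE_four hij hik hjk hil hjl hkl
    (fun x y z t => A i j * A i k * A j l * A k l * (b x y * b x z * b y t * b z t))]
  congr 1; funext w; simp [gh]; ring

lemma gpairsum (S : Finset ι) (c : ι → ι → ℝ) {k l : ι} (hk : k ∈ S) (hl : l ∈ S) (hkl : k ≠ l)
    (hs : ∀ m n, c m n = c n m)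
    (h0 : ∀ m ∈ S, ∀ n ∈ S, ¬ ((m = k ∧ n = l) ∨ (m = l ∧ n = k)) → c m n = 0) :
    ∑ m ∈ S, ∑ n ∈ S, c m n = 2 * c k l := by
  rw [← Finset.sum_product']
  rw [← Finset.sum_subset (s₁ := {(k,l),(l,k)})]
  · rw [Finset.sum_pair (by simp [hkl])]
    rw [hs l k]; ring
  · intro p hp
    simp only [Finset.mem_insert, Finset.mem_singleton] at hp
    rcases hp with rfl | rfl <;> simp [hk, hl]
  · rintro ⟨m, n⟩ hp hn
    simp only [Finset.mem_product] at hp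
    refine h0 m hp.1 n hp.2 ?_
    simpa using hn


lemma gleaf (hA : ∀ i j, A i j = - A j i) (hb0 : ∀ y, ∑ x, b x y = 0) {k l p q r s t v : ι}
    (f : (ι → G) → ℝ)
    (hf : f = gh A b k l * (gh A b p q * gh A b r s * gh A b t v))
    (h : k ≠ p ∧ k ≠ q ∧ k ≠ r ∧ k ≠ s ∧ k ≠ t ∧ k ≠ v) : gE f = 0 := by
  obtain ⟨h1, h2, h3, h4, h5, h6⟩ := h
  rw [hf]
  exact gE_zero hA hb0 (((gh_ind h1 h2).mul (gh_ind h3 h4)).mul (gh_ind h5 h6))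

lemma gleaf' (hA : ∀ i j, A i j = - A j i) (hb : ∀ x y, b x y = - b y x)
    (hb0 : ∀ y, ∑ x, b x y = 0) {k l p q r s t v : ι}
    (f : (ι → G) → ℝ)
    (hf : f = gh A b l k * (gh A b p q * gh A b r s * gh A b t v))
    (h : k ≠ p ∧ k ≠ q ∧ k ≠ r ∧ k ≠ s ∧ k ≠ t ∧ k ≠ v) : gE f = 0 :=
  gleaf hA hb0 f (by rw [hf, gh_symm hA hb l k]) h

section fixed



lemma gTa (hA : ∀ i j, A i j = - A j i) (hb : ∀ x y, b x y = - b y x)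
    (hb0 : ∀ y, ∑ x, b x y = 0) {i j : ι} (hij : i ≠ j) {S : Finset ι}
    (hS : ∀ m, m ∈ S ↔ m ≠ i ∧ m ≠ j) :
    gE (gh A b i j ^ 2 * (∑ k ∈ S, gh A b i k) ^ 2) =
    ∑ k ∈ S, gE (gh A b i j ^ 2 * gh A b i k ^ 2) := by
  rw [sq (∑ k ∈ S, gh A b i k), Finset.sum_mul_sum, Finset.mul_sum, map_sum]
  refine Finset.sum_congr rfl fun k hk => ?_
  rw [Finset.mul_sum, map_sum]
  rw [Finset.sum_eq_single k, sq (gh A b i k)]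
  · intro l hl hlk
    have h1 := (hS k).1 hk
    have h2 := (hS l).1 hl
    exact gleaf' hA hb hb0 (k := l) (l := i) (p := i) (q := j) (r := i) (s := j) (t := i) (v := k)
      _ (by ring) ⟨h2.1, h2.2, h2.1, h2.2, h2.1, hlk⟩
  · intro h; exact absurd hk h

lemma gTb (hA : ∀ i j, A i j = - A j i) (hb : ∀ x y, b x y = - b y x)
    (hb0 : ∀ y, ∑ x, b x y = 0) {i j : ι} (hij : i ≠ j) {S : Finset ι}
    (hS : ∀ m, m ∈ S ↔ m ≠ i ∧ m ≠ j) :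
    gE (gh A b i j ^ 2 * (∑ m ∈ S, ∑ n ∈ S, gh A b m n) ^ 2) =
    2 * ∑ k ∈ S, ∑ l ∈ S, gE (gh A b i j ^ 2 * gh A b k l ^ 2) := by
  rw [sq (∑ m ∈ S, ∑ n ∈ S, gh A b m n)]
  rw [Finset.sum_mul, Finset.mul_sum, map_sum, Finset.mul_sum]
  refine Finset.sum_congr rfl fun k hk => ?_
  rw [Finset.sum_mul, Finset.mul_sum, map_sum, Finset.mul_sum]
  refine Finset.sum_congr rfl fun l hl => ?_
  simp only [Finset.mul_sum, map_sum]
  have h1 := (hS k).1 hk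
  have h2 := (hS l).1 hl
  by_cases hkl : k = l
  · subst hkl
    simp [gh_self hA]
  rw [gpairsum S (fun m n => gE (gh A b i j ^ 2 * (gh A b k l * gh A b m n))) hk hl hkl]
  · rw [sq (gh A b k l)]
  · intro m n; simp only [gh_symm hA hb m n]
  · intro m hm n hn h
    have h3 := (hS m).1 hm
    have h4 := (hS n).1 hn
    by_cases hmk : m = k ∨ m = l
    · -- then n is a leaf, unless m = n
      by_cases hmn : m = n
      · subst hmn; simp [gh_self hA]
      have : n ≠ k ∧ n ≠ l := by
        rcases hmk with rfl | rfl
        · exact ⟨fun h => hmn h.symm, fun h' => h (Or.inl ⟨rfl, h'⟩)⟩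
        · exact ⟨fun h' => h (Or.inr ⟨rfl, h'⟩), fun h => hmn h.symm⟩
      exact gleaf' hA hb hb0 (k := n) (l := m) (p := i) (q := j) (r := i) (s := j) (t := k) (v := l)
        _ (by ring) ⟨h4.1, h4.2, h4.1, h4.2, this.1, this.2⟩
    · push Not at hmk
      exact gleaf hA hb0 (k := m) (l := n) (p := i) (q := j) (r := i) (s := j) (t := k) (v := l)
        _ (by ring) ⟨h3.1, h3.2, h3.1, h3.2, hmk.1, hmk.2⟩

lemma gTc (hA : ∀ i j, A i j = - A j i) (hb : ∀ x y, b x y = - b y x)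
    (hb0 : ∀ y, ∑ x, b x y = 0) {i j : ι} (hij : i ≠ j) {S : Finset ι}
    (hS : ∀ m, m ∈ S ↔ m ≠ i ∧ m ≠ j) :
    gE (gh A b i j ^ 2 * ((∑ k ∈ S, gh A b i k) * ∑ k ∈ S, gh A b j k)) =
    ∑ k ∈ S, gE (gh A b i j ^ 2 * (gh A b i k * gh A b j k)) := by
  rw [Finset.sum_mul_sum, Finset.mul_sum, map_sum]
  refine Finset.sum_congr rfl fun k hk => ?_
  rw [Finset.mul_sum, map_sum]
  rw [Finset.sum_eq_single k]
  · intro l hl hlk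
    have h1 := (hS k).1 hk
    have h2 := (hS l).1 hl
    exact gleaf' hA hb hb0 (k := l) (l := j) (p := i) (q := j) (r := i) (s := j) (t := i) (v := k)
      _ (by ring) ⟨h2.1, h2.2, h2.1, h2.2, h2.1, hlk⟩
  · intro h; exact absurd hk h

lemma gTd (hA : ∀ i j, A i j = - A j i) (hb : ∀ x y, b x y = - b y x)
    (hb0 : ∀ y, ∑ x, b x y = 0) {i j : ι} (hij : i ≠ j) {S : Finset ι}
    (hS : ∀ m, m ∈ S ↔ m ≠ i ∧ m ≠ j) :
    gE (gh A b i j * ((∑ k ∈ S, gh A b i k) ^ 2 * ∑ k ∈ S, gh A b j k)) =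
    ∑ k ∈ S, gE (gh A b i k ^ 2 * (gh A b i j * gh A b j k)) := by
  rw [sq, Finset.sum_mul_sum, Finset.sum_mul, Finset.mul_sum, map_sum]
  refine Finset.sum_congr rfl fun k hk => ?_
  have h1 := (hS k).1 hk
  rw [Finset.sum_mul, Finset.mul_sum, map_sum]
  rw [Finset.sum_eq_single k]
  · rw [Finset.mul_sum, Finset.mul_sum, map_sum]
    rw [Finset.sum_eq_single k]
    · congr 1; ring
    · intro l hl hlk
      have h2 := (hS l).1 hl
      exact gleaf' hA hb hb0 (k := l) (l := j) (p := i) (q := j) (r := i) (s := k) (t := i) (v := k)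
        _ (by ring) ⟨h2.1, h2.2, h2.1, hlk, h2.1, hlk⟩
    · intro h; exact absurd hk h
  · intro l hl hlk
    have h2 := (hS l).1 hl
    rw [Finset.mul_sum, Finset.mul_sum, map_sum]
    refine Finset.sum_eq_zero fun m hm => ?_
    have h3 := (hS m).1 hm
    by_cases hml : m = l
    · subst hml
      exact gleaf' hA hb hb0 (k := k) (l := i) (p := i) (q := j) (r := i) (s := m) (t := j) (v := m)
        _ (by ring) ⟨h1.1, h1.2, h1.1, hlk.symm, h1.2, hlk.symm⟩
    · exact gleaf' hA hb hb0 (k := l) (l := i) (p := i) (q := j) (r := i) (s := k) (t := j) (v := m)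
        _ (by ring) ⟨h2.1, h2.2, h2.1, hlk, h2.2, fun h => hml h.symm⟩
  · intro h; exact absurd hk h

lemma gTe (hA : ∀ i j, A i j = - A j i) (hb : ∀ x y, b x y = - b y x)
    (hb0 : ∀ y, ∑ x, b x y = 0) {i j : ι} (hij : i ≠ j) {S : Finset ι}
    (hS : ∀ m, m ∈ S ↔ m ≠ i ∧ m ≠ j) :
    gE (gh A b i j * ((∑ k ∈ S, gh A b i k) * (∑ k ∈ S, gh A b j k) *
      (∑ m ∈ S, ∑ n ∈ S, gh A b m n))) =
    2 * ∑ k ∈ S, ∑ l ∈ S, gE (gh A b i j * gh A b i k * gh A b j l * gh A b k l) := by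
  rw [Finset.sum_mul_sum, Finset.sum_mul, Finset.mul_sum, map_sum, Finset.mul_sum]
  refine Finset.sum_congr rfl fun k hk => ?_
  have h1 := (hS k).1 hk
  rw [Finset.sum_mul, Finset.mul_sum, map_sum, Finset.mul_sum]
  refine Finset.sum_congr rfl fun l hl => ?_
  have h2 := (hS l).1 hl
  simp only [Finset.mul_sum, map_sum]
  by_cases hkl : k = l
  · subst hkl
    rw [gh_self hA k]
    simp only [mul_zero, map_zero]
    refine Finset.sum_eq_zero fun m hm => Finset.sum_eq_zero fun n hn => ?_
    have h3 := (hS m).1 hm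
    have h4 := (hS n).1 hn
    by_cases hmn : m = n
    · subst hmn; simp [gh_self hA]
    by_cases hmk : m = k
    · subst hmk
      have : n ≠ m := fun h => hmn h.symm
      exact gleaf' hA hb hb0 (k := n) (l := m) (p := i) (q := j) (r := i) (s := m) (t := j) (v := m)
        _ (by ring) ⟨h4.1, h4.2, h4.1, this, h4.2, this⟩
    · exact gleaf hA hb0 (k := m) (l := n) (p := i) (q := j) (r := i) (s := k) (t := j) (v := k)
        _ (by ring) ⟨h3.1, h3.2, h3.1, hmk, h3.2, hmk⟩
  rw [gpairsum S (fun m n => gE (gh A b i j * (gh A b i k * gh A b j l * gh A b m n))) hk hl hkl]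
  · congr 2; ring
  · intro m n; simp only [gh_symm hA hb m n]
  · intro m hm n hn h
    have h3 := (hS m).1 hm
    have h4 := (hS n).1 hn
    by_cases hmk : m = k ∨ m = l
    · by_cases hmn : m = n
      · subst hmn; simp [gh_self hA]
      have : n ≠ k ∧ n ≠ l := by
        rcases hmk with rfl | rfl
        · exact ⟨fun h => hmn h.symm, fun h' => h (Or.inl ⟨rfl, h'⟩)⟩
        · exact ⟨fun h' => h (Or.inr ⟨rfl, h'⟩), fun h => hmn h.symm⟩
      exact gleaf' hA hb hb0 (k := n) (l := m) (p := i) (q := j) (r := i) (s := k) (t := j) (v := l)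
        _ (by ring) ⟨h4.1, h4.2, h4.1, this.1, h4.2, this.2⟩
    · push Not at hmk
      exact gleaf hA hb0 (k := m) (l := n) (p := i) (q := j) (r := i) (s := k) (t := j) (v := l)
        _ (by ring) ⟨h3.1, h3.2, h3.1, hmk.1, h3.2, hmk.2⟩

lemma gZ1 (hA : ∀ i j, A i j = - A j i) (hb : ∀ x y, b x y = - b y x)
    (hb0 : ∀ y, ∑ x, b x y = 0) {i j : ι} (hij : i ≠ j) {S : Finset ι}
    (hS : ∀ m, m ∈ S ↔ m ≠ i ∧ m ≠ j) :
    gE (gh A b i j ^ 3 * ∑ k ∈ S, gh A b i k) = 0 := by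
  rw [Finset.mul_sum, map_sum]
  refine Finset.sum_eq_zero fun k hk => ?_
  have h1 := (hS k).1 hk
  exact gleaf' hA hb hb0 (k := k) (l := i) (p := i) (q := j) (r := i) (s := j) (t := i) (v := j)
    _ (by ring) ⟨h1.1, h1.2, h1.1, h1.2, h1.1, h1.2⟩

lemma gZ2 (hA : ∀ i j, A i j = - A j i) (hb : ∀ x y, b x y = - b y x)
    (hb0 : ∀ y, ∑ x, b x y = 0) {i j : ι} (hij : i ≠ j) {S : Finset ι}
    (hS : ∀ m, m ∈ S ↔ m ≠ i ∧ m ≠ j) :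
    gE (gh A b i j ^ 3 * ∑ m ∈ S, ∑ n ∈ S, gh A b m n) = 0 := by
  simp only [Finset.mul_sum, map_sum]
  refine Finset.sum_eq_zero fun k hk => Finset.sum_eq_zero fun l _ => ?_
  have h1 := (hS k).1 hk
  exact gleaf hA hb0 (k := k) (l := l) (p := i) (q := j) (r := i) (s := j) (t := i) (v := j)
    _ (by ring) ⟨h1.1, h1.2, h1.1, h1.2, h1.1, h1.2⟩

lemma gZ3 (hA : ∀ i j, A i j = - A j i) (hb : ∀ x y, b x y = - b y x)
    (hb0 : ∀ y, ∑ x, b x y = 0) {i j : ι} (hij : i ≠ j) {S : Finset ι}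
    (hS : ∀ m, m ∈ S ↔ m ≠ i ∧ m ≠ j) :
    gE (gh A b i j ^ 2 * ((∑ k ∈ S, gh A b i k) * ∑ m ∈ S, ∑ n ∈ S, gh A b m n)) = 0 := by
  rw [Finset.sum_mul, Finset.mul_sum, map_sum]
  refine Finset.sum_eq_zero fun k hk => ?_
  have h1 := (hS k).1 hk
  simp only [Finset.mul_sum, map_sum]
  refine Finset.sum_eq_zero fun m hm => Finset.sum_eq_zero fun n hn => ?_
  have h3 := (hS m).1 hm
  have h4 := (hS n).1 hn
  by_cases hmn : m = n
  · subst hmn; simp [gh_self hA]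
  by_cases hmk : m = k
  · subst hmk
    have : n ≠ m := fun h => hmn h.symm
    exact gleaf' hA hb hb0 (k := n) (l := m) (p := i) (q := j) (r := i) (s := j) (t := i) (v := m)
      _ (by ring) ⟨h4.1, h4.2, h4.1, h4.2, h4.1, this⟩
  · exact gleaf hA hb0 (k := m) (l := n) (p := i) (q := j) (r := i) (s := j) (t := i) (v := k)
      _ (by ring) ⟨h3.1, h3.2, h3.1, h3.2, h3.1, hmk⟩

lemma gZ4 (hA : ∀ i j, A i j = - A j i) (hb : ∀ x y, b x y = - b y x)
    (hb0 : ∀ y, ∑ x, b x y = 0) {i j : ι} (hij : i ≠ j) {S : Finset ι}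
    (hS : ∀ m, m ∈ S ↔ m ≠ i ∧ m ≠ j)
    (c : ℝ) : gE (gh A b i j *
    (∑ k ∈ S, gh A b j k + c • ∑ m ∈ S, ∑ n ∈ S, gh A b m n) ^ 3) = 0 := by
  refine gE_zero hA hb0 (gInd.pow (gInd.add (gInd.sum _ _ ?_) (gInd.smul _ (gInd.sum _ _ ?_))) _)
  · intro k hk
    exact gh_ind hij ((hS k).1 hk).1.symm
  · intro m hm
    exact gInd.sum _ _ fun n hn => gh_ind ((hS m).1 hm).1.symm ((hS n).1 hn).1.symm

lemma gZ5 (hA : ∀ i j, A i j = - A j i) (hb : ∀ x y, b x y = - b y x)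
    (hb0 : ∀ y, ∑ x, b x y = 0) {i j : ι} (hij : i ≠ j) {S : Finset ι}
    (hS : ∀ m, m ∈ S ↔ m ≠ i ∧ m ≠ j)
    (c : ℝ) : gE (gh A b i j * (c • ∑ m ∈ S, ∑ n ∈ S, gh A b m n) ^ 3) = 0 := by
  refine gE_zero hA hb0 (gInd.pow (gInd.smul _ (gInd.sum _ _ ?_)) _)
  intro m hm
  exact gInd.sum _ _ fun n hn => gh_ind ((hS m).1 hm).1.symm ((hS n).1 hn).1.symm

lemma gX_decomp (hA : ∀ i j, A i j = - A j i) (hb : ∀ x y, b x y = - b y x)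
    (hb0 : ∀ y, ∑ x, b x y = 0) {i j : ι} (hij : i ≠ j) {S : Finset ι}
    (hS : ∀ m, m ∈ S ↔ m ≠ i ∧ m ≠ j) :
    (1/2 : ℝ) • ∑ p, ∑ q, gh A b p q =
    gh A b i j + ∑ k ∈ S, gh A b i k + ∑ k ∈ S, gh A b j k
      + (1/2 : ℝ) • ∑ m ∈ S, ∑ n ∈ S, gh A b m n := by
  have hu : (Finset.univ : Finset ι) = insert i (insert j S) := by
    ext m; simp [hS m]; tauto
  have hi : i ∉ insert j S := by simp [hij, hS]
  have hj : j ∉ S := by simp [hS]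
  rw [hu]
  simp only [Finset.sum_insert hi, Finset.sum_insert hj, Finset.sum_add_distrib]
  have e1 : ∑ x ∈ S, gh A b x i = ∑ x ∈ S, gh A b i x :=
    Finset.sum_congr rfl fun x _ => gh_symm hA hb x i
  have e2 : ∑ x ∈ S, gh A b x j = ∑ x ∈ S, gh A b j x :=
    Finset.sum_congr rfl fun x _ => gh_symm hA hb x j
  rw [e1, e2, gh_self hA, gh_self hA, gh_symm hA hb j i]
  module

lemma gEhX3 (hA : ∀ i j, A i j = - A j i) (hb : ∀ x y, b x y = - b y x)
    (hb0 : ∀ y, ∑ x, b x y = 0) {i j : ι} (hij : i ≠ j) {S : Finset ι}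
    (hS : ∀ m, m ∈ S ↔ m ≠ i ∧ m ≠ j) :
    gE (gh A b i j * ((1/2 : ℝ) • ∑ p, ∑ q, gh A b p q) ^ 3) =
    gE (gh A b i j ^ 4) + 3 * (∑ k ∈ S, gE (gh A b i j ^ 2 * gh A b i k ^ 2)
      + ∑ k ∈ S, gE (gh A b j i ^ 2 * gh A b j k ^ 2)
      + (1/2) * ∑ k ∈ S, ∑ l ∈ S, gE (gh A b i j ^ 2 * gh A b k l ^ 2))
      + 6 * ∑ k ∈ S, gE (gh A b i j ^ 2 * (gh A b i k * gh A b j k))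
      + 3 * ∑ k ∈ S, gE (gh A b i k ^ 2 * (gh A b i j * gh A b j k))
      + 3 * ∑ k ∈ S, gE (gh A b j k ^ 2 * (gh A b j i * gh A b i k))
      + 6 * ∑ k ∈ S, ∑ l ∈ S, gE (gh A b i j * gh A b i k * gh A b j l * gh A b k l) := by
  have hS' : ∀ m, m ∈ S ↔ m ≠ j ∧ m ≠ i := fun m => (hS m).trans and_comm
  rw [gX_decomp hA hb hb0 hij hS, ← gTa hA hb hb0 hij hS, ← gTa hA hb hb0 hij.symm hS',
    ← gTc hA hb hb0 hij hS, ← gTd hA hb hb0 hij hS, ← gTd hA hb hb0 hij.symm hS']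
  have b1 := gTb hA hb hb0 hij hS
  have b2 := gTe hA hb hb0 hij hS
  have z1 := gZ1 hA hb hb0 hij hS
  have z1' := gZ1 hA hb hb0 hij.symm hS'
  have z2 := gZ2 hA hb hb0 hij hS
  have z3 := gZ3 hA hb hb0 hij hS
  have z3' := gZ3 hA hb hb0 hij.symm hS'
  have z4 := gZ4 hA hb hb0 hij hS (1/2)
  have z4' := gZ4 hA hb hb0 hij.symm hS' (1/2)
  have z5 := gZ5 hA hb hb0 hij hS (1/2)
  rw [gh_symm hA hb j i] at z1' z3' z4' ⊢
  generalize (∑ k ∈ S, ∑ l ∈ S, gE (gh A b i j ^ 2 * gh A b k l ^ 2)) = r1 at *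
  generalize (∑ k ∈ S, ∑ l ∈ S, gE (gh A b i j * gh A b i k * gh A b j l * gh A b k l)) = r2 at *
  generalize (∑ m ∈ S, ∑ n ∈ S, gh A b m n) = V at *
  generalize (∑ k ∈ S, gh A b i k) = U at *
  generalize (∑ k ∈ S, gh A b j k) = U' at *
  generalize gh A b i j = h at *
  have key : h * (h + U + U' + (1/2:ℝ) • V) ^ 3 = h ^ 4 + (3:ℝ) • (h^2 * U^2) +
      (3:ℝ) • (h^2 * U'^2) + (3/4:ℝ) • (h^2 * V^2) + (6:ℝ) • (h^2 * (U * U'))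
      + (3:ℝ) • (h * (U^2 * U')) + (3:ℝ) • (h * (U'^2 * U)) + (3:ℝ) • (h * (U * U' * V))
      + (3:ℝ) • (h^3 * U) + (3:ℝ) • (h^3 * U') + (3/2:ℝ) • (h^3 * V)
      + (3:ℝ) • (h^2 * (U * V)) + (3:ℝ) • (h^2 * (U' * V))
      + h * (U + (1/2:ℝ) • V)^3 + h * (U' + (1/2:ℝ) • V)^3 - h * ((1/2:ℝ) • V)^3 := by
    funext w
    simp only [Pi.mul_apply, Pi.add_apply, Pi.pow_apply, Pi.smul_apply, Pi.sub_apply, smul_eq_mul]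
    ring
  rw [key]
  simp only [map_add, map_sub, map_smul, smul_eq_mul]
  rw [b1, b2, z1, z1', z2, z3, z3', z4, z4', z5]
  ring

end fixed


section total


lemma gSsum {i j : ι} (hij : i ≠ j) (f : ι → ℝ) :
    ∑ k ∈ (Finset.univ.erase i).erase j, f k = ∑ k, f k - f i - f j := by
  rw [← Finset.add_sum_erase Finset.univ f (Finset.mem_univ i),
    ← Finset.add_sum_erase (Finset.univ.erase i) f (a := j) (by simp [hij.symm])]
  ring


lemma gEv (hA : ∀ i j, A i j = - A j i) (hb : ∀ x y, b x y = - b y x)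
    (hb0 : ∀ y, ∑ x, b x y = 0)
    (hr : ∀ x, ∑ y, b x y ^ 2 = (∑ x, ∑ y, b x y ^ 2) / (Fintype.card G : ℝ))
    (β4 β2 τ γ : ℝ)
    (h4 : β4 = (∑ x, ∑ y, b x y ^ 4) / (Fintype.card G : ℝ)^2)
    (h2 : β2 = (∑ x, ∑ y, b x y ^ 2) / (Fintype.card G : ℝ)^2)
    (ht : τ = (∑ x, ∑ y, ∑ z, b x y ^ 2 * (b x z * b y z)) / (Fintype.card G : ℝ)^3)
    (hg : γ = (∑ x, ∑ y, ∑ z, ∑ t, b x y * b x z * b y t * b z t) / (Fintype.card G : ℝ)^4)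
    (i j : ι) :
    gE (gh A b i j * ((1/2 : ℝ) • ∑ p, ∑ q, gh A b p q) ^ 3) =
      A i j ^ 4 * β4 + 3 * β2 ^ 2 * (A i j ^ 2 * ((∑ p, ∑ q, A p q ^ 2) / 2 - A i j ^ 2))
      + 6 * τ * ∑ k, A i j ^ 2 * (A i k * A j k)
      + 3 * τ * ∑ k, A i k ^ 2 * (A i j * A k j)
      + 3 * τ * ∑ k, A j k ^ 2 * (A j i * A k i)
      + 6 * γ * (∑ k, ∑ l, A i j * A i k * A j l * A k l - A i j ^ 2 * ∑ k, A i k ^ 2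
          - A i j ^ 2 * ∑ k, A j k ^ 2 + A i j ^ 4) := by
  have hA0 : ∀ i, A i i = 0 := fun i => by linarith [hA i i]
  by_cases hij : i = j
  · subst hij
    rw [gh_self hA]
    simp [hA0]
  set S := (Finset.univ.erase i).erase j with hSdef
  have hS : ∀ m, m ∈ S ↔ m ≠ i ∧ m ≠ j := fun m => by simp [hSdef, and_comm]
  rw [gEhX3 hA hb hb0 hij hS]
  have v1 : ∑ k ∈ S, gE (gh A b i j ^ 2 * gh A b i k ^ 2) =
      ∑ k ∈ S, A i j ^ 2 * A i k ^ 2 * β2 ^ 2 := Finset.sum_congr rfl fun k hk => by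
    have h1 := (hS k).1 hk
    rw [gval22_adj hij h1.1.symm h1.2.symm hr, h2]
  have v2 : ∑ k ∈ S, gE (gh A b j i ^ 2 * gh A b j k ^ 2) =
      ∑ k ∈ S, A i j ^ 2 * A j k ^ 2 * β2 ^ 2 := Finset.sum_congr rfl fun k hk => by
    have h1 := (hS k).1 hk
    rw [gval22_adj (Ne.symm hij) h1.2.symm h1.1.symm hr, h2, hA j i]; ring
  have v3 : ∑ k ∈ S, ∑ l ∈ S, gE (gh A b i j ^ 2 * gh A b k l ^ 2) =
      ∑ k ∈ S, ∑ l ∈ S, A i j ^ 2 * A k l ^ 2 * β2 ^ 2 :=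
    Finset.sum_congr rfl fun k hk => Finset.sum_congr rfl fun l hl => by
      have h1 := (hS k).1 hk
      have h3 := (hS l).1 hl
      by_cases hkl : k = l
      · subst hkl; rw [gh_self hA, hA0]; simp
      rw [gval22_disj hij h1.1.symm h1.2.symm h3.1.symm h3.2.symm hkl, h2]
  have v4 : ∑ k ∈ S, gE (gh A b i j ^ 2 * (gh A b i k * gh A b j k)) =
      ∑ k ∈ S, A i j ^ 2 * (A i k * A j k) * τ := Finset.sum_congr rfl fun k hk => by
    have h1 := (hS k).1 hk
    rw [gval_tri hij h1.1.symm h1.2.symm, ht]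
  have v5 : ∑ k ∈ S, gE (gh A b i k ^ 2 * (gh A b i j * gh A b j k)) =
      ∑ k ∈ S, A i k ^ 2 * (A i j * A k j) * τ := Finset.sum_congr rfl fun k hk => by
    have h1 := (hS k).1 hk
    rw [gh_symm hA hb j k, gval_tri h1.1.symm hij h1.2, ht]
  have v6 : ∑ k ∈ S, gE (gh A b j k ^ 2 * (gh A b j i * gh A b i k)) =
      ∑ k ∈ S, A j k ^ 2 * (A j i * A k i) * τ := Finset.sum_congr rfl fun k hk => by
    have h1 := (hS k).1 hk
    rw [gh_symm hA hb i k, gval_tri h1.2.symm (Ne.symm hij) h1.1, ht]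
  have v7 : ∑ k ∈ S, ∑ l ∈ S, gE (gh A b i j * gh A b i k * gh A b j l * gh A b k l) =
      ∑ k ∈ S, ∑ l ∈ S, A i j * A i k * A j l * A k l * γ :=
    Finset.sum_congr rfl fun k hk => Finset.sum_congr rfl fun l hl => by
      have h1 := (hS k).1 hk
      have h3 := (hS l).1 hl
      by_cases hkl : k = l
      · subst hkl; rw [gh_self hA, hA0]; simp
      rw [gval_cyc hij h1.1.symm h1.2.symm h3.1.symm h3.2.symm hkl, hg]
  rw [v1, v2, v3, v4, v5, v6, v7, gval4 hij, ← h4]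
  simp only [hSdef, gSsum hij, Finset.sum_sub_distrib]
  simp only [← Finset.sum_mul, ← Finset.mul_sum, hA0]
  have c1 : ∑ k, A k i ^ 2 = ∑ k, A i k ^ 2 :=
    Finset.sum_congr rfl fun k _ => by rw [hA k i]; ring
  have c2 : ∑ k, A k j ^ 2 = ∑ k, A j k ^ 2 :=
    Finset.sum_congr rfl fun k _ => by rw [hA k j]; ring
  have c3 : ∑ k, A i j * A i k * A j i * A k i = A i j ^ 2 * ∑ k, A i k ^ 2 := by
    rw [Finset.mul_sum]
    exact Finset.sum_congr rfl fun k _ => by rw [hA k i, hA j i]; ring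
  have c4 : ∑ k, A j k * A j k = ∑ k, A j k ^ 2 :=
    Finset.sum_congr rfl fun k _ => by ring
  have c5 : ∑ k, A i j * A i j * A j k * A j k = A i j ^ 2 * ∑ k, A j k ^ 2 := by
    rw [Finset.mul_sum]
    exact Finset.sum_congr rfl fun k _ => by ring
  rw [c1, c2, c3, c5, hA j i]
  simp only [mul_zero, zero_mul, Finset.sum_const_zero]
  ring

lemma gTotal (hA : ∀ i j, A i j = - A j i) (hb : ∀ x y, b x y = - b y x)
    (hb0 : ∀ y, ∑ x, b x y = 0)
    (hr : ∀ x, ∑ y, b x y ^ 2 = (∑ x, ∑ y, b x y ^ 2) / (Fintype.card G : ℝ))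
    (β4 β2 τ γ : ℝ)
    (h4 : β4 = (∑ x, ∑ y, b x y ^ 4) / (Fintype.card G : ℝ)^2)
    (h2 : β2 = (∑ x, ∑ y, b x y ^ 2) / (Fintype.card G : ℝ)^2)
    (ht : τ = (∑ x, ∑ y, ∑ z, b x y ^ 2 * (b x z * b y z)) / (Fintype.card G : ℝ)^3)
    (hg : γ = (∑ x, ∑ y, ∑ z, ∑ t, b x y * b x z * b y t * b z t) / (Fintype.card G : ℝ)^4) :
    gE (((1/2 : ℝ) • ∑ p, ∑ q, gh A b p q) ^ 4) =
      1/2 * β4 * (∑ i, ∑ j, A i j ^ 4) +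
      3 * β2 ^ 2 * ((∑ i, ∑ j, A i j ^ 2) ^ 2 / 4 - (∑ i, ∑ j, A i j ^ 4) / 2) +
      6 * τ * (∑ i, ∑ j, ∑ k, A i j ^ 2 * (A i k * A j k)) +
      3 * γ * ((∑ i, ∑ j, ∑ k, ∑ l, A i j * A i k * A j l * A k l)
        - 2 * ∑ i, (∑ j, A i j ^ 2) ^ 2 + ∑ i, ∑ j, A i j ^ 4) := by
  have e : ((1/2 : ℝ) • ∑ p, ∑ q, gh A b p q) ^ 4 = (1/2 : ℝ) • ∑ i, ∑ j,
      (gh A b i j * ((1/2 : ℝ) • ∑ p, ∑ q, gh A b p q) ^ 3) := by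
    simp only [← Finset.sum_mul]
    rw [pow_succ' _ 3, smul_mul_assoc]
  rw [e]
  simp only [map_smul, map_sum, smul_eq_mul]
  simp only [gEv hA hb hb0 hr β4 β2 τ γ h4 h2 ht hg]
  generalize hP : (∑ p, ∑ q, A p q ^ 2) = P
  simp only [Finset.sum_add_distrib, Finset.sum_sub_distrib, ← Finset.mul_sum, ← Finset.sum_mul,
    mul_sub]
  have t1 : ∑ i, ∑ j, ∑ k, A i k ^ 2 * (A i j * A k j) =
      ∑ i, ∑ j, ∑ k, A i j ^ 2 * (A i k * A j k) :=
    Finset.sum_congr rfl fun i _ => Finset.sum_comm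
  have t2 : ∑ i, ∑ j, ∑ k, A j k ^ 2 * (A j i * A k i) =
      ∑ i, ∑ j, ∑ k, A i j ^ 2 * (A i k * A j k) := by
    rw [Finset.sum_comm]
    exact Finset.sum_congr rfl fun i _ => Finset.sum_comm
  have t3 : ∑ i, (∑ j, A i j ^ 2) * ∑ k, A i k ^ 2 = ∑ i, (∑ j, A i j ^ 2) ^ 2 :=
    Finset.sum_congr rfl fun i _ => by ring
  have t4 : ∑ i, ∑ j, A i j ^ 2 * ∑ k, A j k ^ 2 = ∑ i, (∑ j, A i j ^ 2) ^ 2 := by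
    rw [Finset.sum_comm]
    refine Finset.sum_congr rfl fun j _ => ?_
    rw [← Finset.sum_mul, sq]
    congr 1
    exact Finset.sum_congr rfl fun k _ => by rw [hA k j]; ring
  have t5 : ∑ i, ∑ j, A i j ^ 2 * A i j ^ 2 = ∑ i, ∑ j, A i j ^ 4 :=
    Finset.sum_congr rfl fun i _ => Finset.sum_congr rfl fun k _ => by ring
  have t6 : ∑ i, ∑ j, ∑ k, A i j ^ 2 * (A i k * A j k) =
      ∑ i, ∑ j, A i j ^ 2 * ∑ k, A i k * A j k := by simp only [Finset.mul_sum]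
  rw [t1, t2, t3, t4, t5, t6, hP]
  ring

end total

end moment


lemma gF_a2 (N : ℕ) : ∑ i : Fin N, ∑ k : Fin N, gA N i k ^ 2 =
    (N:ℝ)^4/3 - N^3 + 2/3 * (N:ℝ)^2 := by
  rw [← g_a2]
  simp only [Finset.sum_range]

lemma gF_a4 (N : ℕ) : ∑ i : Fin N, ∑ k : Fin N, gA N i k ^ 4 =
    (N:ℝ)^6/5 - N^5 + 4/3 * (N:ℝ)^4 - 8/15 * (N:ℝ)^2 := by
  rw [← g_a4]
  simp only [Finset.sum_range]

lemma gF_sq (N : ℕ) (i k : Fin N) : ∑ j : Fin N, gA N i j * gA N j k = gC N (gd i k) := by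
  rw [← gA_sq N i k i.2 k.2]
  simp only [Finset.sum_range]

lemma gF_row (N : ℕ) (i : Fin N) : ∑ j : Fin N, gA N i j ^ 2 =
    (N:ℝ)^3/3 - N^2 + 2/3 * N := by
  have := gF_sq N i i
  have e : ∑ j : Fin N, gA N i j ^ 2 = - ∑ j : Fin N, gA N i j * gA N j i := by
    rw [← Finset.sum_neg_distrib]
    exact Finset.sum_congr rfl fun j _ => by rw [gA_anti N j i]; ring
  rw [e, this]
  simp [gd, gC]; ring

lemma gF_t (N : ℕ) : ∑ i : Fin N, ∑ j : Fin N, ∑ k : Fin N,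
      gA N i j ^ 2 * (gA N i k * gA N j k) =
    2/45 * (N:ℝ)^7 - 1/3 * (N:ℝ)^6 + 7/9 * (N:ℝ)^5 - 2/3 * (N:ℝ)^4 + 8/45 * (N:ℝ)^3 := by
  have := g_t N
  simp only [Finset.sum_range] at this
  have e : ∑ i : Fin N, ∑ j : Fin N, ∑ k : Fin N, gA N i j ^ 2 * (gA N i k * gA N j k) =
      - ∑ i : Fin N, ∑ j : Fin N, gA N i j ^ 2 * gC N (gd i j) := by
    rw [← Finset.sum_neg_distrib]
    refine Finset.sum_congr rfl fun i _ => ?_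
    rw [← Finset.sum_neg_distrib]
    refine Finset.sum_congr rfl fun j _ => ?_
    rw [← gF_sq, Finset.mul_sum, ← Finset.sum_neg_distrib]
    refine Finset.sum_congr rfl fun k _ => ?_
    rw [gA_anti N j k]; ring
  rw [e, this]; ring

lemma gF_c4 (N : ℕ) : ∑ i : Fin N, ∑ j : Fin N, ∑ k : Fin N, ∑ l : Fin N,
      gA N i j * gA N i k * gA N j l * gA N k l =
    1/45 * (N:ℝ)^8 - 4/9 * (N:ℝ)^6 + (N:ℝ)^5 - 26/45 * (N:ℝ)^4 := by
  rw [← g_c4]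
  simp only [Finset.sum_range]
  refine Finset.sum_congr rfl fun i _ => ?_
  have e : ∀ l : Fin N, gC N (gd i l) ^ 2 =
      ∑ j : Fin N, ∑ k : Fin N, gA N i j * gA N i k * gA N j l * gA N k l := fun l => by
    rw [← gF_sq, sq, Finset.sum_mul_sum]
    exact Finset.sum_congr rfl fun j _ => Finset.sum_congr rfl fun k _ => by ring
  simp only [e]
  symm
  rw [Finset.sum_comm]
  exact Finset.sum_congr rfl fun j _ => Finset.sum_comm

lemma gF_rowsum (N : ℕ) (i : Fin N) : ∑ j : Fin N, gA N i j = 0 := by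
  rw [← gA_row N i i.2]
  simp only [Finset.sum_range]

/-- the (signed) statistic of a word -/
noncomputable def gX {n : ℕ} (w : Fin n → ℕ) : ℝ :=
  1/2 * ∑ i : Fin n, ∑ j : Fin n, gA n i j * gsg (w i) (w j)

lemma gX_words {n N : ℕ} (w : Fin n → Fin N) :
    (N:ℝ) * gX (fun i => (w i : ℕ)) = ((1/2 : ℝ) • ∑ p : Fin n, ∑ q : Fin n,
      gh (fun i j : Fin n => gA n i j) (fun x y : Fin N => gA N x y) p q) w := by
  have z1 : ∑ i : Fin n, ∑ j : Fin n, gA n i j * ((w i : ℕ) : ℝ) = 0 := by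
    simp only [← Finset.sum_mul, gF_rowsum]; simp
  have z2 : ∑ i : Fin n, ∑ j : Fin n, gA n i j * ((w j : ℕ) : ℝ) = 0 := by
    rw [Finset.sum_comm]
    have : ∀ j : Fin n, ∑ i : Fin n, gA n i j = 0 := fun j => by
      rw [← neg_zero, ← gF_rowsum n j, ← Finset.sum_neg_distrib]
      exact Finset.sum_congr rfl fun i _ => gA_anti n i j
    simp only [← Finset.sum_mul, this]; simp
  have e : ∀ i j : Fin n, gA n i j * gA N (w i) (w j) = N * (gA n i j * gsg (w i) (w j))
      - 2 * (gA n i j * ((w j : ℕ) : ℝ)) + 2 * (gA n i j * ((w i : ℕ) : ℝ)) := fun i j => by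
    nth_rewrite 2 [gA]; ring
  simp only [Pi.smul_apply, Finset.sum_apply, gh, smul_eq_mul, e, Finset.sum_add_distrib,
    Finset.sum_sub_distrib, ← Finset.mul_sum, z1, z2]
  unfold gX
  ring

lemma gX_moment (n N : ℕ) (hN : 0 < N) :
    (∑ w : Fin n → Fin N, gX (fun i => (w i : ℕ)) ^ 4) / (N:ℝ)^n =
      1/2 * (1/5 - (1/(N:ℝ)) + 4/3 * (1/(N:ℝ))^2 - 8/15 * (1/(N:ℝ))^4) *
        (∑ i : Fin n, ∑ j : Fin n, gA n i j ^ 4) +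
      3 * (1/3 - (1/(N:ℝ)) + 2/3 * (1/(N:ℝ))^2) ^ 2 *
        ((∑ i : Fin n, ∑ j : Fin n, gA n i j ^ 2) ^ 2 / 4
          - (∑ i : Fin n, ∑ j : Fin n, gA n i j ^ 4) / 2) +
      6 * (2/45 - 1/3 * (1/(N:ℝ)) + 7/9 * (1/(N:ℝ))^2 - 2/3 * (1/(N:ℝ))^3 + 8/45 * (1/(N:ℝ))^4) *
        (∑ i : Fin n, ∑ j : Fin n, ∑ k : Fin n, gA n i j ^ 2 * (gA n i k * gA n j k)) +
      3 * (1/45 - 4/9 * (1/(N:ℝ))^2 + (1/(N:ℝ))^3 - 26/45 * (1/(N:ℝ))^4) *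
        ((∑ i : Fin n, ∑ j : Fin n, ∑ k : Fin n, ∑ l : Fin n,
          gA n i j * gA n i k * gA n j l * gA n k l)
        - 2 * ∑ i : Fin n, (∑ j : Fin n, gA n i j ^ 2) ^ 2
          + ∑ i : Fin n, ∑ j : Fin n, gA n i j ^ 4) := by
  have : Nonempty (Fin N) := ⟨⟨0, hN⟩⟩
  have hN0 : (N:ℝ) ≠ 0 := by positivity
  have key := gTotal (A := fun i j : Fin n => gA n i j) (b := fun x y : Fin N => gA N x y)
    (fun i j => gA_anti n i j) (fun i j => gA_anti N i j)
    (fun y => by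
      rw [← neg_zero, ← gF_rowsum N y, ← Finset.sum_neg_distrib]
      exact Finset.sum_congr rfl fun i _ => gA_anti N i y)
    (fun x => by
      rw [gF_row, gF_a2, Fintype.card_fin]; field_simp)
    _ _ _ _ rfl rfl rfl rfl
  rw [gF_a4 N, gF_a2 N, gF_t N, gF_c4 N, Fintype.card_fin] at key
  have e : gE (((1/2 : ℝ) • ∑ p : Fin n, ∑ q : Fin n,
      gh (fun i j : Fin n => gA n i j) (fun x y : Fin N => gA N x y) p q) ^ 4) =
      (N:ℝ)^4 * ((∑ w : Fin n → Fin N, gX (fun i => (w i : ℕ)) ^ 4) / (N:ℝ)^n) := by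
    rw [← mul_div_assoc, Finset.mul_sum]
    change (∑ w, (((1/2 : ℝ) • ∑ p : Fin n, ∑ q : Fin n,
      gh (fun i j : Fin n => gA n i j) (fun x y : Fin N => gA N x y) p q) ^ 4) w) / _ = _
    simp only [Pi.pow_apply, ← gX_words, mul_pow]
    simp
  rw [e] at key
  refine mul_left_cancel₀ (pow_ne_zero 4 hN0) (key.trans ?_)
  generalize (∑ i : Fin n, ∑ j : Fin n, gA n i j ^ 4) = P1
  generalize (∑ i : Fin n, ∑ j : Fin n, gA n i j ^ 2) = P2
  generalize (∑ i : Fin n, ∑ j : Fin n, ∑ k : Fin n, gA n i j ^ 2 * (gA n i k * gA n j k)) = P3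
  generalize (∑ i : Fin n, ∑ j : Fin n, ∑ k : Fin n, ∑ l : Fin n,
          gA n i j * gA n i k * gA n j l * gA n k l) = P4
  generalize (∑ i : Fin n, (∑ j : Fin n, gA n i j ^ 2) ^ 2) = P5
  field_simp

open Filter Topology in
lemma gX_lim (n : ℕ) : Tendsto (fun N : ℕ =>
    (∑ w : Fin n → Fin N, gX (fun i => (w i : ℕ)) ^ 4) / (N:ℝ)^n) atTop
    (𝓝 (16 * ((n : ℝ) ^ 3 * ((n : ℝ) - 1) * ((n : ℝ) - 2)
        * (29 * (n : ℝ) ^ 3 - 71 * (n : ℝ) ^ 2 - 26 * (n : ℝ) - 16) / 43200))) := by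
  have h := tendsto_one_div_atTop_nhds_zero_nat (𝕜 := ℝ)
  have hc : ∀ P1 P2 P3 P4 : ℝ, Continuous (fun x : ℝ =>
    1/2 * (1/5 - x + 4/3 * x^2 - 8/15 * x^4) * P1 + 3 * (1/3 - x + 2/3 * x^2) ^ 2 * P2
    + 6 * (2/45 - 1/3 * x + 7/9 * x^2 - 2/3 * x^3 + 8/45 * x^4) * P3
    + 3 * (1/45 - 4/9 * x^2 + x^3 - 26/45 * x^4) * P4) := fun P1 P2 P3 P4 => by fun_prop
  have h2 := fun P1 P2 P3 P4 => ((hc P1 P2 P3 P4).tendsto 0).comp h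
  have h3 := h2 (∑ i : Fin n, ∑ j : Fin n, gA n i j ^ 4)
    ((∑ i : Fin n, ∑ j : Fin n, gA n i j ^ 2) ^ 2 / 4
          - (∑ i : Fin n, ∑ j : Fin n, gA n i j ^ 4) / 2)
    (∑ i : Fin n, ∑ j : Fin n, ∑ k : Fin n, gA n i j ^ 2 * (gA n i k * gA n j k))
    ((∑ i : Fin n, ∑ j : Fin n, ∑ k : Fin n, ∑ l : Fin n,
          gA n i j * gA n i k * gA n j l * gA n k l)
        - 2 * ∑ i : Fin n, (∑ j : Fin n, gA n i j ^ 2) ^ 2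
          + ∑ i : Fin n, ∑ j : Fin n, gA n i j ^ 4)
  have h4 := h3.congr' (f₂ := fun N : ℕ =>
    (∑ w : Fin n → Fin N, gX (fun i => (w i : ℕ)) ^ 4) / (N:ℝ)^n) (by
      filter_upwards [eventually_gt_atTop 0] with N hN
      rw [gX_moment n N hN]
      rfl)
  convert h4 using 2
  simp only [gF_a4, gF_a2, gF_t, gF_c4, gF_row, Finset.sum_const, Finset.card_univ,
    Fintype.card_fin, nsmul_eq_mul]
  ring


lemma gsg_strict {n : ℕ} (v : Fin n → ℕ) (hv : StrictMono v) (a c : Fin n) :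
    gsg (v a) (v c) = gsg a c := by
  unfold gsg
  simp only [hv.lt_iff_lt, Fin.lt_def]

lemma gX_perm_sum {n : ℕ} (w : Fin n → ℕ) (hw : Function.Injective w) :
    ∑ σ : Equiv.Perm (Fin n), gX (fun i => w (σ i)) ^ 4 =
      ∑ σ : Equiv.Perm (Fin n), gX (fun i => (σ i : ℕ)) ^ 4 := by
  have hv : StrictMono (w ∘ Tuple.sort w) :=
    (Tuple.monotone_sort w).strictMono_of_injective (hw.comp (Tuple.sort w).injective)
  rw [← Equiv.sum_comp (Equiv.mulLeft (Tuple.sort w))]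
  refine Finset.sum_congr rfl fun σ _ => ?_
  congr 1
  unfold gX
  congr 1
  refine Finset.sum_congr rfl fun i _ => Finset.sum_congr rfl fun j _ => ?_
  congr 1
  exact gsg_strict _ hv (σ i) (σ j)

lemma gX_inj_sum (n N : ℕ) (S : ℝ)
    (hS : ∑ σ : Equiv.Perm (Fin n), gX (fun i => (σ i : ℕ)) ^ 4 = n.factorial * S) :
    ∑ w : Fin n → Fin N, (if Function.Injective w then gX (fun i => (w i : ℕ)) ^ 4 - S else 0)
      = 0 := by
  classical
  have hf : (n.factorial : ℝ) ≠ 0 := by exact_mod_cast n.factorial_ne_zero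
  have h1 : ∀ σ : Equiv.Perm (Fin n), ∑ w : Fin n → Fin N,
      (if Function.Injective w then gX (fun i => (w i : ℕ)) ^ 4 - S else 0) =
      ∑ w : Fin n → Fin N,
      (if Function.Injective w then gX (fun i => (w (σ i) : ℕ)) ^ 4 - S else 0) := by
    intro σ
    rw [← Equiv.sum_comp (Equiv.arrowCongr σ.symm (Equiv.refl (Fin N)))]
    refine Finset.sum_congr rfl fun w _ => ?_
    have : Function.Injective ((Equiv.arrowCongr σ.symm (Equiv.refl (Fin N))) w) ↔
        Function.Injective w := by
      change Function.Injective (w ∘ σ) ↔ _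
      exact Equiv.injective_comp σ w
    simp only [this]
    rfl
  have h2 : (n.factorial : ℝ) * ∑ w : Fin n → Fin N,
      (if Function.Injective w then gX (fun i => (w i : ℕ)) ^ 4 - S else 0) = 0 := by
    have : (n.factorial : ℝ) * ∑ w : Fin n → Fin N,
      (if Function.Injective w then gX (fun i => (w i : ℕ)) ^ 4 - S else 0) =
      ∑ σ : Equiv.Perm (Fin n), ∑ w : Fin n → Fin N,
      (if Function.Injective w then gX (fun i => (w (σ i) : ℕ)) ^ 4 - S else 0) := by
      rw [← Finset.sum_congr rfl (fun σ _ => h1 σ)]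
      simp [Fintype.card_perm]
    rw [this, Finset.sum_comm]
    refine Finset.sum_eq_zero fun w _ => ?_
    split_ifs with hw
    · rw [Finset.sum_sub_distrib]
      rw [gX_perm_sum (fun i => (w i : ℕ)) (Fin.val_injective.comp hw), hS]
      simp [Fintype.card_perm]
    · simp
  exact (mul_eq_zero.1 h2).resolve_left hf

lemma gX_bound {n : ℕ} (w : Fin n → ℕ) :
    |gX w| ≤ 1/2 * ∑ i : Fin n, ∑ j : Fin n, |gA n i j| := by
  unfold gX
  rw [abs_mul, abs_of_pos (by norm_num : (0:ℝ) < 1/2)]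
  refine mul_le_mul_of_nonneg_left ?_ (by norm_num)
  refine (Finset.abs_sum_le_sum_abs _ _).trans (Finset.sum_le_sum fun i _ => ?_)
  refine (Finset.abs_sum_le_sum_abs _ _).trans (Finset.sum_le_sum fun j _ => ?_)
  rw [abs_mul]
  refine mul_le_of_le_one_right (abs_nonneg _) ?_
  unfold gsg; split_ifs <;> simp

open Filter Topology in
lemma gX_lim2 (n : ℕ) : Tendsto (fun N : ℕ =>
    (∑ w : Fin n → Fin N, gX (fun i => (w i : ℕ)) ^ 4) / (N:ℝ)^n) atTop
    (𝓝 ((∑ σ : Equiv.Perm (Fin n), gX (fun i => (σ i : ℕ)) ^ 4) / n.factorial)) := by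
  classical
  have hf : (n.factorial : ℝ) ≠ 0 := by exact_mod_cast n.factorial_ne_zero
  set S := (∑ σ : Equiv.Perm (Fin n), gX (fun i => (σ i : ℕ)) ^ 4) / n.factorial with hSd
  have hS : ∑ σ : Equiv.Perm (Fin n), gX (fun i => (σ i : ℕ)) ^ 4 = n.factorial * S := by
    rw [hSd]; field_simp
  set c := 1/2 * ∑ i : Fin n, ∑ j : Fin n, |gA n i j| with hc
  have hK : ∀ w : Fin n → ℕ, |gX w ^ 4 - S| ≤ c ^ 4 + |S| := fun w => by
    refine (abs_sub _ _).trans ?_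
    rw [abs_pow]
    gcongr
    exact gX_bound w
  have hd : Tendsto (fun N : ℕ => (c^4 + |S|) * (1 - (N.descFactorial n : ℝ) / (N:ℝ)^n))
      atTop (𝓝 0) := by
    have h1 : Tendsto (fun N : ℕ => (N.descFactorial n : ℝ) / (N:ℝ)^n) atTop (𝓝 1) := by
      refine (Asymptotics.isEquivalent_iff_tendsto_one ?_).1 (isEquivalent_descFactorial n)
      filter_upwards [eventually_gt_atTop 0] with N hN
      positivity
    have := (h1.const_sub 1).const_mul (c^4 + |S|)
    simpa using this
  rw [tendsto_iff_norm_sub_tendsto_zero]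
  refine squeeze_zero' (Eventually.of_forall fun _ => norm_nonneg _) ?_ hd
  filter_upwards [eventually_gt_atTop 0] with N hN
  have hNn : (0:ℝ) < (N:ℝ)^n := by positivity
  have e1 : (∑ w : Fin n → Fin N, gX (fun i => (w i : ℕ)) ^ 4) / (N:ℝ)^n - S =
      (∑ w : Fin n → Fin N, (if Function.Injective w then 0
        else gX (fun i => (w i : ℕ)) ^ 4 - S)) / (N:ℝ)^n := by
    have e2 : ∑ w : Fin n → Fin N, (gX (fun i => (w i : ℕ)) ^ 4 - S) =
      ∑ w : Fin n → Fin N, (if Function.Injective w then 0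
        else gX (fun i => (w i : ℕ)) ^ 4 - S) := by
      have z := gX_inj_sum n N S hS
      have hsplit : ∑ w : Fin n → Fin N, (gX (fun i => (w i : ℕ)) ^ 4 - S) =
          ∑ w : Fin n → Fin N, (if Function.Injective w then 0
            else gX (fun i => (w i : ℕ)) ^ 4 - S)
          + ∑ w : Fin n → Fin N, (if Function.Injective w
            then gX (fun i => (w i : ℕ)) ^ 4 - S else 0) := by
        rw [← Finset.sum_add_distrib]
        refine Finset.sum_congr rfl fun w _ => ?_
        split_ifs <;> simp
      rw [hsplit]
      convert add_zero _
    rw [← e2, Finset.sum_sub_distrib, sub_div]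
    congr 1
    simp
    field_simp
  rw [e1, Real.norm_eq_abs, abs_div, abs_of_pos hNn, div_le_iff₀ hNn]
  have hcard : ∑ w : Fin n → Fin N, (if Function.Injective w then (0:ℝ) else 1) =
      (N:ℝ)^n - N.descFactorial n := by
    have h3 : ∑ w : Fin n → Fin N, (if Function.Injective w then (1:ℝ) else 0) =
        N.descFactorial n := by
      rw [Finset.sum_boole]
      have := Fintype.card_embedding_eq (α := Fin n) (β := Fin N)
      rw [Fintype.card_fin, Fintype.card_fin] at this
      rw [← this, ← Fintype.card_subtype]
      norm_cast
      exact Fintype.card_congr (Equiv.subtypeInjectiveEquivEmbedding _ _)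
    rw [← h3, eq_sub_iff_add_eq, ← Finset.sum_add_distrib]
    have : ∀ w : Fin n → Fin N, ((if Function.Injective w then (0:ℝ) else 1) +
      (if Function.Injective w then (1:ℝ) else 0)) = 1 := fun w => by split_ifs <;> simp
    simp [this]
  calc _ ≤ ∑ w : Fin n → Fin N, |(if Function.Injective w then 0
        else gX (fun i => (w i : ℕ)) ^ 4 - S)| := Finset.abs_sum_le_sum_abs _ _
    _ ≤ ∑ w : Fin n → Fin N, (c^4 + |S|) * (if Function.Injective w then (0:ℝ) else 1) := by
        refine Finset.sum_le_sum fun w _ => ?_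
        split_ifs
        · simp
        · rw [mul_one]; exact hK _
    _ = _ := by
        rw [← Finset.mul_sum, hcard]
        field_simp

lemma gX_main (n : ℕ) :
    (∑ σ : Equiv.Perm (Fin n), gX (fun i => (σ i : ℕ)) ^ 4) / n.factorial =
    16 * ((n : ℝ) ^ 3 * ((n : ℝ) - 1) * ((n : ℝ) - 2)
        * (29 * (n : ℝ) ^ 3 - 71 * (n : ℝ) ^ 2 - 26 * (n : ℝ) - 16) / 43200) :=
  tendsto_nhds_unique (gX_lim2 n) (gX_lim n)

lemma gcount_Ioi {n : ℕ} (j : Fin n) : ∑ k : Fin n, (if j < k then (1:ℝ) else 0) = n - 1 - j := by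
  rw [Finset.sum_boole]
  have : (Finset.univ.filter (fun k => j < k)) = Finset.Ioi j := by ext; simp
  rw [this, Fin.card_Ioi]
  have := j.2
  rw [Nat.cast_sub (by omega), Nat.cast_sub (by omega)]; simp

lemma gcount_Iio {n : ℕ} (j : Fin n) : ∑ k : Fin n, (if k < j then (1:ℝ) else 0) = j := by
  rw [Finset.sum_boole]
  have : (Finset.univ.filter (fun k => k < j)) = Finset.Iio j := by ext; simp
  rw [this, Fin.card_Iio]

lemma gcount_Ioo {n : ℕ} {i k : Fin n} (h : i < k) :
    ∑ j : Fin n, (if i < j ∧ j < k then (1:ℝ) else 0) = k - i - 1 := by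
  rw [Finset.sum_boole]
  have : (Finset.univ.filter (fun j => i < j ∧ j < k)) = Finset.Ioo i k := by ext; simp
  rw [this, Fin.card_Ioo]
  have : (i:ℕ) < k := h
  rw [Nat.cast_sub (by omega), Nat.cast_sub (by omega)]; simp

lemma gX_half {n : ℕ} (w : Fin n → ℕ) : gX w =
    ∑ i : Fin n, ∑ j : Fin n, if i < j then
      ((n:ℝ) - 2 * ((j:ℕ) - (i:ℕ))) * gsg (w i) (w j) else 0 := by
  set f : Fin n → Fin n → ℝ := fun i j => if i < j then
      ((n:ℝ) - 2 * ((j:ℕ) - (i:ℕ))) * gsg (w i) (w j) else 0 with hf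
  have e : ∀ i j : Fin n, gA n i j * gsg (w i) (w j) = f i j + f j i := by
    intro i j
    simp only [hf]
    rcases lt_trichotomy i j with h | h | h
    · have h' : (i:ℕ) < j := h
      simp [h, h.not_gt, gA, gsg, h']
    · subst h; simp [gA_self]
    · have h' : (j:ℕ) < i := h
      rw [gsg_anti (w i) (w j), gA_anti]
      simp [h, h.not_gt]
      left
      simp [gA, gsg, h']
  unfold gX
  simp only [e, Finset.sum_add_distrib]
  rw [Finset.sum_comm (f := fun i j => f j i)]
  ring

lemma gep_gX {n : ℕ} (π : Equiv.Perm (Fin n)) :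
    (gep (fun i => π i) : ℝ) - (n : ℝ) * ((n : ℝ) - 1) * ((n : ℝ) - 2) / 12 =
      -(1/2) * gX (fun i => (π i : ℕ)) := by
  set e : Fin n → Fin n → ℝ := fun i j => gsg (π i) (π j) with he
  have h1 : (gep (fun i => π i) : ℝ) = ∑ i : Fin n, ∑ j : Fin n, ∑ k : Fin n,
      (1/2) * ((if i < j ∧ j < k then (1:ℝ) else 0)
        - (if i < j ∧ j < k then e i j else 0)
        - (if i < j ∧ j < k then e j k else 0)
        + (if i < j ∧ j < k then e i k else 0)) := by
    unfold gep
    rw [← Finset.sum_boole, Fintype.sum_prod_type]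
    refine Finset.sum_congr rfl fun i _ => ?_
    rw [Fintype.sum_prod_type]
    refine Finset.sum_congr rfl fun j _ => Finset.sum_congr rfl fun k _ => ?_
    by_cases h : i < j ∧ j < k
    · have hij : (π i : ℕ) ≠ π j := fun h' => h.1.ne (π.injective (Fin.ext h'))
      have hjk : (π j : ℕ) ≠ π k := fun h' => h.2.ne (π.injective (Fin.ext h'))
      have hik : (π i : ℕ) ≠ π k := fun h' => (h.1.trans h.2).ne (π.injective (Fin.ext h'))
      simp only [h.1, h.2, true_and, if_true, he, gsg, Fin.lt_def, and_self]
      generalize (π i : ℕ) = a at *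
      generalize (π j : ℕ) = b at *
      generalize (π k : ℕ) = c at *
      rcases lt_or_gt_of_ne hij with h1 | h1 <;> rcases lt_or_gt_of_ne hjk with h2 | h2 <;>
        rcases lt_or_gt_of_ne hik with h3 | h3 <;>
        first
          | (exfalso; omega)
          | (simp [h1, h2, h3, h1.not_gt, h2.not_gt, h3.not_gt]; try norm_num)
    · rw [if_neg (fun h' => h ⟨h'.1, h'.2.1⟩)]
      simp [h]
  have s1 : ∑ i : Fin n, ∑ j : Fin n, ∑ k : Fin n, (if i < j ∧ j < k then (1:ℝ) else 0) =
      n * (n - 1) * (n - 2) / 6 := by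
    have : ∀ j : Fin n, ∑ i : Fin n, ∑ k : Fin n, (if i < j ∧ j < k then (1:ℝ) else 0) =
        0 + (n - 1) * ((j:ℕ):ℝ) + (-1) * ((j:ℕ):ℝ)^2 + 0 * ((j:ℕ):ℝ)^3 + 0 * ((j:ℕ):ℝ)^4
          + 0 * ((j:ℕ):ℝ)^5 := by
      intro j
      have e1 : ∀ i k : Fin n, (if i < j ∧ j < k then (1:ℝ) else 0) =
        (if i < j then (1:ℝ) else 0) * (if j < k then (1:ℝ) else 0) := fun i k => by
          split_ifs <;> simp_all
      simp only [e1]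
      rw [← Finset.sum_mul_sum, gcount_Iio, gcount_Ioi]; ring
    rw [Finset.sum_comm]
    simp only [this]
    have h := gsumpoly 0 (n - 1) (-1) 0 0 0 n
    rw [Finset.sum_range] at h
    rw [h]; ring
  have s2 : ∑ i : Fin n, ∑ j : Fin n, ∑ k : Fin n, (if i < j ∧ j < k then e i j else 0) =
      ∑ i : Fin n, ∑ j : Fin n, if i < j then ((n:ℝ) - 1 - (j:ℕ)) * e i j else 0 := by
    refine Finset.sum_congr rfl fun i _ => Finset.sum_congr rfl fun j _ => ?_
    by_cases h : i < j
    · simp only [h, true_and, if_true]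
      rw [← gcount_Ioi j, Finset.sum_mul]
      exact Finset.sum_congr rfl fun k _ => by split_ifs <;> simp
    · simp [h]
  have s3 : ∑ i : Fin n, ∑ j : Fin n, ∑ k : Fin n, (if i < j ∧ j < k then e j k else 0) =
      ∑ i : Fin n, ∑ j : Fin n, if i < j then ((i:ℕ):ℝ) * e i j else 0 := by
    rw [Finset.sum_comm]
    refine Finset.sum_congr rfl fun i _ => ?_
    rw [Finset.sum_comm]
    refine Finset.sum_congr rfl fun j _ => ?_
    by_cases h : i < j
    · simp only [h, and_true, if_true]
      rw [← gcount_Iio i, Finset.sum_mul]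
      exact Finset.sum_congr rfl fun k _ => by split_ifs <;> simp
    · simp [h]
  have s4 : ∑ i : Fin n, ∑ j : Fin n, ∑ k : Fin n, (if i < j ∧ j < k then e i k else 0) =
      ∑ i : Fin n, ∑ j : Fin n, if i < j then (((j:ℕ):ℝ) - (i:ℕ) - 1) * e i j else 0 := by
    refine Finset.sum_congr rfl fun i _ => ?_
    rw [Finset.sum_comm]
    refine Finset.sum_congr rfl fun k _ => ?_
    by_cases h : i < k
    · rw [if_pos h, ← gcount_Ioo h, Finset.sum_mul]
      exact Finset.sum_congr rfl fun k _ => by split_ifs <;> simp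
    · rw [if_neg h]
      refine Finset.sum_eq_zero fun j _ => if_neg fun h' => h (h'.1.trans h'.2)
  have s5 : gX (fun i => (π i : ℕ)) =
      (∑ i : Fin n, ∑ j : Fin n, if i < j then ((n:ℝ) - 1 - (j:ℕ)) * e i j else 0)
      + (∑ i : Fin n, ∑ j : Fin n, if i < j then ((i:ℕ):ℝ) * e i j else 0)
      - (∑ i : Fin n, ∑ j : Fin n, if i < j then (((j:ℕ):ℝ) - (i:ℕ) - 1) * e i j else 0) := by
    rw [gX_half, ← Finset.sum_add_distrib, ← Finset.sum_sub_distrib]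
    refine Finset.sum_congr rfl fun i _ => ?_
    rw [← Finset.sum_add_distrib, ← Finset.sum_sub_distrib]
    refine Finset.sum_congr rfl fun j _ => ?_
    split_ifs
    · simp only [he]; ring
    · simp
  rw [h1, s5, ← s2, ← s3, ← s4]
  simp only [← Finset.mul_sum, Finset.sum_add_distrib, Finset.sum_sub_distrib]
  rw [s1]
  ring

theorem gep_perm_fourth_central_moment (n : ℕ) (hn : 1 ≤ n) :
    (∑ π : Equiv.Perm (Fin n),
        ((gep (fun i => π i) : ℚ) - (n : ℚ) * ((n : ℚ) - 1) * ((n : ℚ) - 2) / 12) ^ 4)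
      / (n.factorial : ℚ) =
      (n : ℚ) ^ 3 * ((n : ℚ) - 1) * ((n : ℚ) - 2)
        * (29 * (n : ℚ) ^ 3 - 71 * (n : ℚ) ^ 2 - 26 * (n : ℚ) - 16) / 43200 := by
  have key : (∑ π : Equiv.Perm (Fin n),
        ((gep (fun i => π i) : ℝ) - (n : ℝ) * ((n : ℝ) - 1) * ((n : ℝ) - 2) / 12) ^ 4)
      / (n.factorial : ℝ) =
      (n : ℝ) ^ 3 * ((n : ℝ) - 1) * ((n : ℝ) - 2)
        * (29 * (n : ℝ) ^ 3 - 71 * (n : ℝ) ^ 2 - 26 * (n : ℝ) - 16) / 43200 := by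
    have h := gX_main n
    simp only [gep_gX, mul_pow, ← Finset.mul_sum]
    rw [mul_div_assoc, h]
    ring
  exact_mod_cast key
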